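/- In Ỹ (with higher modes defined by the recursion in the context), for every i ∈ {0,m} and all r,s ∈ ℤ_{≥0}: (1) [h_{i,r}, x^±_{i,s}] = 0 (in particular relation (1.4) of the affine super Yangian holds with i = j, since a_{i,i} = 0 and b_{i,i} = 0 for i ∈ {0,m}), and (2) [h_{i,r}, h_{i,s}] = 0. -/

import Mathlib

noncomputable section

open scoped BigOperators

/-- The parity function `p` on indices, realized on `ZMod (m+n)`:
`p(i) = 0` for `1 ≤ i ≤ m` and `p(i) = 1` otherwise (so `p(0) = 1`). -/
def ppar (m n : ℕ) (i : ZMod (m + n)) : ℕ :=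
  if 1 ≤ i.val ∧ i.val ≤ m then 0 else 1

/-- Parity of the generators `x^±_{i,r}`: they are odd exactly when `i = 0` or `i = m`. -/
def gpar (m n : ℕ) (i : ZMod (m + n)) : ℕ := (ppar m n i + ppar m n (i + 1)) % 2

/-- The integer valued Cartan matrix `a_{i,j}` of `\hat{sl}(m|n)`.
The cyclic cases `(0, m+n-1)` and `(m+n-1, 0)` are covered by the clauses
`j = i - 1` and `j = i + 1` in `ZMod (m+n)`. -/
def aZ (m n : ℕ) (i j : ZMod (m + n)) : ℤ :=
  if i = j then (-1) ^ ppar m n i + (-1) ^ ppar m n (i + 1)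
  else if j = i + 1 then -(-1) ^ ppar m n (i + 1)
  else if j = i - 1 then -(-1) ^ ppar m n i
  else 0

/-- `a_{i,j}` as a complex number. -/
def aC (m n : ℕ) (i j : ZMod (m + n)) : ℂ := (aZ m n i j : ℂ)

/-- The matrix `b_{i,j}`. -/
def bC (m n : ℕ) (i j : ZMod (m + n)) : ℂ :=
  if i = ((m + n - 1 : ℕ) : ZMod (m + n)) ∧ j = 0 then 1
  else if i = j + 1 then -(-1) ^ ppar m n (i + 1)
  else if i = j - 1 then (-1) ^ ppar m n i
  else 0

variable {A : Type*} [Ring A] [Algebra ℂ A]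

/-- The supercommutator `[x,y] = xy - (-1)^{p(x)p(y)} yx` of elements of parities `px`, `py`. -/
def sbr (px py : ℕ) (x y : A) : A := x * y - ((-1 : ℂ) ^ (px * py)) • (y * x)

/-- The anticommutator `{x,y} = xy + yx`. -/
def acm (x y : A) : A := x * y + y * x

/-- The sign `±1` governing the `x^+`/`x^-` cases. -/
def sgn (b : Bool) : ℂ := if b then 1 else -1

/-- Iterated super-adjoint action `(ad x)^k y`, where `x` has parity `px` and `y` parity `py`. -/
def adPow (px : ℕ) (x : A) (py : ℕ) (y : A) : ℕ → A
  | 0 => y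
  | k + 1 => sbr px ((py + k * px) % 2) x (adPow px x py y k)

/-- Nested supercommutator `[g 0, [g 1, … , [g (k-1), y] … ]]` where every `g l`
has parity `px` and `y` has parity `py`. -/
def serreNest (px py : ℕ) : (k : ℕ) → (Fin k → A) → A → A
  | 0, _, y => y
  | k + 1, g, y => sbr px ((py + k * px) % 2) (g 0) (serreNest px py k (fun l => g l.succ) y)

/-- `h̃_{i,1} = h_{i,1} - ((ε₁+ε₂)/2) h_{i,0}²`. -/
def htld (m n : ℕ) (ε₁ ε₂ : ℂ) (H : ZMod (m + n) → ℕ → A) (i : ZMod (m + n)) : A :=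
  H i 1 - ((ε₁ + ε₂) / 2) • (H i 0 * H i 0)

/-- A representation of the minimalistic presentation `Ỹ` of the affine super Yangian
`Y_{ε₁,ε₂}(ŝl(m|n))`: elements `x^±_{i,r}`, `h_{i,r}` of an associative `ℂ`-algebra
satisfying the defining relations (2.1)–(2.9) for the modes `r ∈ {0,1}`, together with
the recursive definition of the higher modes `r ≥ 2`. -/
structure YtildeRep (m n : ℕ) (ε₁ ε₂ : ℂ) (A : Type*) [Ring A] [Algebra ℂ A] where
  /-- `x^+_{i,r}` (`b = true`) and `x^-_{i,r}` (`b = false`). -/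
  X : Bool → ZMod (m + n) → ℕ → A
  /-- `h_{i,r}`. -/
  H : ZMod (m + n) → ℕ → A
  rel21 : ∀ (i j : ZMod (m + n)) (r s : ℕ), r ≤ 1 → s ≤ 1 → H i r * H j s = H j s * H i r
  rel22 : ∀ i j : ZMod (m + n),
      sbr (gpar m n i) (gpar m n j) (X true i 0) (X false j 0) = if i = j then H i 0 else 0
  rel23a : ∀ i j : ZMod (m + n),
      sbr (gpar m n i) (gpar m n j) (X true i 1) (X false j 0) = if i = j then H i 1 else 0
  rel23b : ∀ i j : ZMod (m + n),
      sbr (gpar m n i) (gpar m n j) (X true i 0) (X false j 1) = if i = j then H i 1 else 0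
  rel24 : ∀ (b : Bool) (i j : ZMod (m + n)) (r : ℕ), r ≤ 1 →
      H i 0 * X b j r - X b j r * H i 0 = (sgn b * aC m n i j) • X b j r
  rel25 : ∀ (b : Bool) (i j : ZMod (m + n)),
      htld m n ε₁ ε₂ H i * X b j 0 - X b j 0 * htld m n ε₁ ε₂ H i
        = (sgn b * aC m n i j) • (X b j 1 - (bC m n i j * ((ε₁ - ε₂) / 2)) • X b j 0)
  rel26 : ∀ (b : Bool) (i j : ZMod (m + n)),
      sbr (gpar m n i) (gpar m n j) (X b i 1) (X b j 0)
          - sbr (gpar m n i) (gpar m n j) (X b i 0) (X b j 1)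
        = (sgn b * aC m n i j * ((ε₁ + ε₂) / 2)) • acm (X b i 0) (X b j 0)
          - (bC m n i j * ((ε₁ - ε₂) / 2)) •
              sbr (gpar m n i) (gpar m n j) (X b i 0) (X b j 0)
  rel27 : ∀ (b : Bool) (i j : ZMod (m + n)), i ≠ j →
      adPow (gpar m n i) (X b i 0) (gpar m n j) (X b j 0) (1 + (aZ m n i j).natAbs) = 0
  rel28 : ∀ (b : Bool) (i : ZMod (m + n)), i = 0 ∨ i = (m : ZMod (m + n)) →
      sbr (gpar m n i) (gpar m n i) (X b i 0) (X b i 0) = 0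
  rel29 : ∀ (b : Bool) (i : ZMod (m + n)), i = 0 ∨ i = (m : ZMod (m + n)) →
      sbr ((gpar m n (i - 1) + gpar m n i) % 2) ((gpar m n i + gpar m n (i + 1)) % 2)
        (sbr (gpar m n (i - 1)) (gpar m n i) (X b (i - 1) 0) (X b i 0))
        (sbr (gpar m n i) (gpar m n (i + 1)) (X b i 0) (X b (i + 1) 0)) = 0
  recX : ∀ (b : Bool) (i : ZMod (m + n)) (r : ℕ), 1 ≤ r →
      X b i (r + 1) =
        if i = 0 ∨ i = (m : ZMod (m + n)) then
          (sgn b * (aC m n (i + 1) i)⁻¹) •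
              (htld m n ε₁ ε₂ H (i + 1) * X b i r - X b i r * htld m n ε₁ ε₂ H (i + 1))
            + (bC m n (i + 1) i * ((ε₁ - ε₂) / 2)) • X b i r
        else
          (sgn b * (aC m n i i)⁻¹) •
            (htld m n ε₁ ε₂ H i * X b i r - X b i r * htld m n ε₁ ε₂ H i)
  recH : ∀ (i : ZMod (m + n)) (r : ℕ), 1 ≤ r →
      H i (r + 1) = sbr (gpar m n i) (gpar m n i) (X true i (r + 1)) (X false i 0)


/-- The bracket `x y - σ y x`: the commutator for `σ = 1`, the anticommutator for `σ = -1`. -/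
def qbr (σ : ℂ) (x y : A) : A := x * y - σ • (y * x)

section qbr

variable (σ τ : ℂ) (x y z : A)

lemma qbr_add_left : qbr σ (x + y) z = qbr σ x z + qbr σ y z := by
  simp only [qbr, add_mul, mul_add]; module

lemma qbr_add_right : qbr σ x (y + z) = qbr σ x y + qbr σ x z := by
  simp only [qbr, add_mul, mul_add]; module

lemma qbr_sub_left : qbr σ (x - y) z = qbr σ x z - qbr σ y z := by
  simp only [qbr, sub_mul, mul_sub]; module

lemma qbr_sub_right : qbr σ x (y - z) = qbr σ x y - qbr σ x z := by
  simp only [qbr, sub_mul, mul_sub]; module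

lemma qbr_smul_left : qbr σ (τ • x) y = τ • qbr σ x y := by
  simp only [qbr, smul_mul_assoc, mul_smul_comm]; module

lemma qbr_smul_right : qbr σ x (τ • y) = τ • qbr σ x y := by
  simp only [qbr, smul_mul_assoc, mul_smul_comm]; module

lemma qbr_zero_left : qbr σ 0 x = 0 := by simp [qbr]

lemma qbr_zero_right : qbr σ x 0 = 0 := by simp [qbr]

lemma qbr_one_eq_zero_iff : qbr 1 x y = 0 ↔ x * y = y * x := by
  simp [qbr, sub_eq_zero]

lemma qbr_one_swap : qbr 1 x y = -qbr 1 y x := by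
  simp [qbr]

/-- The commutator with a fixed element is a derivation of every bracket. -/
lemma qbr_one_qbr : qbr 1 x (qbr σ y z) = qbr σ (qbr 1 x y) z + qbr σ y (qbr 1 x z) := by
  simp only [qbr, mul_sub, sub_mul, smul_mul_assoc, mul_smul_comm, mul_assoc, one_smul]; module

lemma qbr_anti_sub_anti :
    qbr σ (qbr (-1) x y) z - qbr σ y (qbr (-1) x z) = qbr 1 x (qbr (-σ) y z) := by
  simp only [qbr, mul_sub, sub_mul, smul_mul_assoc, mul_smul_comm, mul_assoc, one_smul]; module

lemma qbr_anti_right :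
    qbr σ y (qbr (-1) x z) = qbr (-1) x (qbr σ y z) - qbr (-σ) (qbr 1 x y) z := by
  simp only [qbr, mul_sub, sub_mul, smul_mul_assoc, mul_smul_comm, mul_assoc, one_smul]; module

/-- If `z` commutes with `y`, bracketing on the right with `z` only sees `x`. -/
lemma qbr_qbr_of_commute_left (h : y * z = z * y) :
    qbr σ (qbr τ x y) z = qbr τ (qbr σ x z) y := by
  have h1 : x * (y * z) = x * (z * y) := by rw [h]
  have h2 : y * (z * x) = z * (y * x) := by rw [← mul_assoc, h, mul_assoc]
  simp only [qbr, mul_sub, sub_mul, smul_mul_assoc, mul_smul_comm, mul_assoc, h1, h2]; module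

lemma qbr_qbr_of_commute_right (h : x * z = z * x) :
    qbr σ x (qbr τ y z) = qbr τ (qbr σ x y) z := by
  have h1 : x * (z * y) = z * (x * y) := by rw [← mul_assoc, h, mul_assoc]
  have h2 : y * (z * x) = y * (x * z) := by rw [h]
  simp only [qbr, mul_sub, sub_mul, smul_mul_assoc, mul_smul_comm, mul_assoc, h1, h2]; module

lemma qbr_one_mul_self_of_eq_zero (h : qbr 1 x y = 0) : qbr 1 (x * x) y = 0 := by
  rw [qbr_one_eq_zero_iff] at *
  rw [mul_assoc, h, ← mul_assoc, h, mul_assoc]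

lemma qbr_one_qbr_of_eq_smul {w : A} (hx : qbr 1 w x = τ • x) (hy : qbr 1 w y = (-τ) • y) :
    qbr 1 w (qbr σ x y) = 0 := by
  rw [qbr_one_qbr, hx, hy, qbr_smul_left, qbr_smul_right]; module

end qbr

/-- Two adjacent nodes of the diagram: `x r`, `y r` are the modes `x^±_{i,r}` of the first one,
`X r`, `Y r` those of the second one, `t` and `u` are the corresponding `h̃_{·,1}`, and `σ`, `τ`
the signs of the brackets `[x^+, x^-]`. -/
structure LinkedNodes (A : Type*) [Ring A] [Algebra ℂ A] where
  /-- The sign of the bracket at the first node. -/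
  σ : ℂ
  /-- The sign of the bracket at the second node. -/
  τ : ℂ
  /-- The off-diagonal Cartan entry. -/
  a : ℂ
  /-- The diagonal Cartan entry at the first node. -/
  α : ℂ
  /-- The diagonal Cartan entry at the second node. -/
  β : ℂ
  /-- The coefficient of the anticommutator. -/
  κ : ℂ
  /-- The coefficient of the quadratic correction. -/
  c : ℂ
  /-- Positive modes at the first node. -/
  x : ℕ → A
  /-- Negative modes at the first node. -/
  y : ℕ → A
  /-- Positive modes at the second node. -/
  X : ℕ → A
  /-- Negative modes at the second node. -/
  Y : ℕ → A
  /-- The shift element of the first node. -/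
  t : A
  /-- The shift element of the second node. -/
  u : A
  a_ne : a ≠ 0
  t_x : ∀ r, qbr 1 t (x r) = α • x (r + 1)
  t_y : ∀ r, qbr 1 t (y r) = (-α) • y (r + 1)
  t_X : ∀ r, qbr 1 t (X r) = a • X (r + 1)
  t_Y : ∀ r, qbr 1 t (Y r) = (-a) • Y (r + 1)
  u_x : ∀ r, qbr 1 u (x r) = a • x (r + 1)
  u_y : ∀ r, qbr 1 u (y r) = (-a) • y (r + 1)
  u_X : ∀ r, qbr 1 u (X r) = β • X (r + 1)
  u_Y : ∀ r, qbr 1 u (Y r) = (-β) • Y (r + 1)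
  x_Y : ∀ r s, x r * Y s = Y s * x r
  y_X : ∀ r s, y r * X s = X s * y r
  x_X : ∀ r s, qbr 1 (x (r + 1)) (X s) - qbr 1 (x r) (X (s + 1)) = κ • qbr (-1) (x r) (X s)
  y_Y : ∀ r s, qbr 1 (y (r + 1)) (Y s) - qbr 1 (y r) (Y (s + 1)) = (-κ) • qbr (-1) (y r) (Y s)
  h_X : ∀ r, qbr 1 (qbr σ (x 0) (y 0)) (X r) = a • X r
  h_Y : ∀ r, qbr 1 (qbr σ (x 0) (y 0)) (Y r) = (-a) • Y r
  h_x : ∀ r, qbr 1 (qbr τ (X 0) (Y 0)) (x r) = a • x r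
  h_y : ∀ r, qbr 1 (qbr τ (X 0) (Y 0)) (y r) = (-a) • y r
  h_fst : qbr σ (x 1) (y 0) = qbr σ (x 0) (y 1)
  h_snd : qbr τ (X 1) (Y 0) = qbr τ (X 0) (Y 1)
  h_comm : qbr 1 (qbr σ (x 1) (y 0)) (qbr τ (X 1) (Y 0)) = 0
  t_eq : t = qbr σ (x 1) (y 0) - c • (qbr σ (x 0) (y 0) * qbr σ (x 0) (y 0))
  u_eq : u = qbr τ (X 1) (Y 0) - c • (qbr τ (X 0) (Y 0) * qbr τ (X 0) (Y 0))

namespace LinkedNodes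

/-- Exchange the two nodes. -/
def swap (N : LinkedNodes A) : LinkedNodes A where
  σ := N.τ
  τ := N.σ
  a := N.a
  α := N.β
  β := N.α
  κ := N.κ
  c := N.c
  x := N.X
  y := N.Y
  X := N.x
  Y := N.y
  t := N.u
  u := N.t
  a_ne := N.a_ne
  t_x := N.u_X
  t_y := N.u_Y
  t_X := N.u_x
  t_Y := N.u_y
  u_x := N.t_X
  u_y := N.t_Y
  u_X := N.t_x
  u_Y := N.t_y
  x_Y r s := (N.y_X s r).symm
  y_X r s := (N.x_Y s r).symm
  x_X r s := by
    have h := N.x_X s r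
    simp only [qbr] at h ⊢
    linear_combination (norm := module) h
  y_Y r s := by
    have h := N.y_Y s r
    simp only [qbr] at h ⊢
    linear_combination (norm := module) h
  h_X := N.h_x
  h_Y := N.h_y
  h_x := N.h_X
  h_y := N.h_Y
  h_fst := N.h_snd
  h_snd := N.h_fst
  h_comm := by rw [qbr_one_swap, N.h_comm, neg_zero]
  t_eq := N.u_eq
  u_eq := N.t_eq

variable (N : LinkedNodes A)

/-- The bracket `[x^+_r, x^-_s]` at the first node. -/
def P (r s : ℕ) : A := qbr N.σ (N.x r) (N.y s)

/-- The bracket `[x^+_r, x^-_s]` at the second node. -/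
def Q (r s : ℕ) : A := qbr N.τ (N.X r) (N.Y s)

lemma t_P (r s : ℕ) : qbr 1 N.t (N.P r s) = N.α • (N.P (r + 1) s - N.P r (s + 1)) := by
  simp only [P, qbr_one_qbr, N.t_x, N.t_y, qbr_smul_left, qbr_smul_right]; module

lemma t_Q (r s : ℕ) : qbr 1 N.t (N.Q r s) = N.a • (N.Q (r + 1) s - N.Q r (s + 1)) := by
  simp only [Q, qbr_one_qbr, N.t_X, N.t_Y, qbr_smul_left, qbr_smul_right]; module

lemma u_P (r s : ℕ) : qbr 1 N.u (N.P r s) = N.a • (N.P (r + 1) s - N.P r (s + 1)) :=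
  N.swap.t_Q r s

lemma P_zero_Q (r s : ℕ) : qbr 1 (N.P 0 0) (N.Q r s) = 0 :=
  qbr_one_qbr_of_eq_smul _ _ _ _ (N.h_X r) (N.h_Y s)

lemma Q_zero_P (r s : ℕ) : qbr 1 (N.Q 0 0) (N.P r s) = 0 :=
  N.swap.P_zero_Q r s

lemma P_succ_X (r s q : ℕ) :
    qbr 1 (N.P (r + 1) s) (N.X q)
      = qbr 1 (N.P r s) (N.X (q + 1)) + N.κ • qbr (-1) (N.P r s) (N.X q) := by
  have h := congrArg (fun z => qbr N.σ z (N.y s)) (N.x_X r q)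
  simp only [qbr_sub_left, qbr_smul_left] at h
  rw [qbr_qbr_of_commute_left _ _ _ _ _ (N.y_X s q).symm,
    qbr_qbr_of_commute_left _ _ _ _ _ (N.y_X s (q + 1)).symm,
    qbr_qbr_of_commute_left _ _ _ _ _ (N.y_X s q).symm] at h
  exact sub_eq_iff_eq_add'.mp h

lemma P_succ_Y (r s q : ℕ) :
    qbr 1 (N.P r (s + 1)) (N.Y q)
      = qbr 1 (N.P r s) (N.Y (q + 1)) - N.κ • qbr (-1) (N.P r s) (N.Y q) := by
  have h := congrArg (fun z => qbr N.σ (N.x r) z) (N.y_Y s q)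
  simp only [qbr_sub_right, qbr_smul_right] at h
  rw [qbr_qbr_of_commute_right _ _ _ _ _ (N.x_Y r q),
    qbr_qbr_of_commute_right _ _ _ _ _ (N.x_Y r (q + 1)),
    qbr_qbr_of_commute_right _ _ _ _ _ (N.x_Y r q)] at h
  rw [sub_eq_add_neg, ← neg_smul]
  exact sub_eq_iff_eq_add'.mp h

/-- The modes `h_{i,r}` of both nodes are well defined and commute, up to total degree `M`. -/
def IsStable (M : ℕ) : Prop :=
  (∀ r s, r + s ≤ M → N.P r s = N.P (r + s) 0) ∧
  (∀ r s, r + s ≤ M → N.Q r s = N.Q (r + s) 0) ∧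
  ∀ l p q, l + p + q ≤ M → qbr 1 (N.P l 0) (N.Q p q) = 0

variable {N} {M : ℕ}

lemma IsStable.swap (h : N.IsStable M) : N.swap.IsStable M := by
  refine ⟨h.2.1, h.1, fun l p q hl => ?_⟩
  change qbr 1 (N.Q l 0) (N.P p q) = 0
  rw [h.1 p q (by omega), qbr_one_swap, h.2.2 (p + q) l 0 (by omega), neg_zero]

lemma IsStable.P_succ_zero_Y (h : N.IsStable M) {l : ℕ} (hl : l + 1 ≤ M) (q : ℕ) :
    qbr 1 (N.P (l + 1) 0) (N.Y q)
      = qbr 1 (N.P l 0) (N.Y (q + 1)) - N.κ • qbr (-1) (N.P l 0) (N.Y q) := by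
  rw [← h.1 l 1 hl]
  exact N.P_succ_Y l 0 q

lemma IsStable.t_P_eq_zero (h : N.IsStable M) {l : ℕ} (hl : l + 1 ≤ M) :
    qbr 1 N.t (N.P l 0) = 0 := by
  rw [N.t_P, h.1 l 1 hl, sub_self, smul_zero]

lemma IsStable.t_Q_eq_zero (h : N.IsStable M) {p q : ℕ} (hl : p + q + 1 ≤ M) :
    qbr 1 N.t (N.Q p q) = 0 := by
  rw [N.t_Q, h.2.1 (p + 1) q (by omega), h.2.1 p (q + 1) (by omega),
    show p + 1 + q = p + (q + 1) by omega, sub_self, smul_zero]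

lemma IsStable.t_bracket (h : N.IsStable M) (l : ℕ) :
    ∀ p q, l + p + q = M →
      qbr 1 N.t (qbr N.τ (N.X p) (qbr 1 (N.P l 0) (N.Y q)))
        = (N.a * N.κ) • qbr 1 (N.P l 0) (qbr (-N.τ) (N.X p) (N.Y q))
          - N.a • qbr 1 N.t (N.Q M 0) := by
  induction l with
  | zero =>
    intro p q hM
    have h1 := qbr_one_qbr_of_eq_smul (-N.τ) _ _ _ (N.h_X p) (N.h_Y q)
    have h2 : qbr 1 (N.P 0 0) (N.Y q) = (-N.a) • N.Y q := N.h_Y q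
    change qbr 1 (N.P 0 0) _ = 0 at h1
    rw [h1, h2, qbr_smul_right, qbr_smul_right]
    have h3 := h.2.1 p q (by omega)
    rw [show p + q = M by omega] at h3
    rw [← h3, Q]; module
  | succ l ih =>
    intro p q hM
    have hX := N.P_succ_X l 0 p
    have hY := h.P_succ_zero_Y (l := l) (by omega) q
    have hQ : qbr 1 (N.P l 0) (qbr N.τ (N.X p) (N.Y q)) = 0 := h.2.2 l p q (by omega)
    have ht : qbr 1 N.t (qbr N.τ (N.X p) (N.Y q)) = 0 := h.t_Q_eq_zero (by omega)
    have h1 := h.t_P_eq_zero (l := l) (by omega)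
    have h2 := qbr_anti_sub_anti (-N.τ) (N.P l 0) (N.X p) (N.Y q)
    rw [neg_neg, hQ] at h2
    have h3 := ih p (q + 1) (by omega)
    have h4 : qbr 1 N.t (qbr N.τ (N.X p) (qbr (-1) (N.P l 0) (N.Y q)))
        = -(N.a • qbr (-N.τ) (qbr 1 (N.P l 0) (N.X (p + 1))) (N.Y q)
            - N.a • qbr (-N.τ) (qbr 1 (N.P l 0) (N.X p)) (N.Y (q + 1))) := by
      rw [qbr_anti_right]
      simp only [qbr_sub_right]
      rw [qbr_one_qbr (-1), h1, ht, qbr_one_qbr (-N.τ), qbr_one_qbr 1 N.t, h1, N.t_X, N.t_Y]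
      simp only [qbr_zero_left, qbr_zero_right, qbr_smul_right, qbr_smul_left,
        zero_add]
      module
    have h5 : qbr 1 (N.P (l + 1) 0) (qbr (-N.τ) (N.X p) (N.Y q))
        = qbr (-N.τ) (qbr 1 (N.P l 0) (N.X (p + 1))) (N.Y q)
          + qbr (-N.τ) (N.X p) (qbr 1 (N.P l 0) (N.Y (q + 1))) := by
      rw [qbr_one_qbr, hX, hY]
      simp only [qbr_add_left, qbr_sub_right, qbr_smul_left, qbr_smul_right]
      linear_combination (norm := module) N.κ • h2
    rw [h5, hY, qbr_sub_right, qbr_sub_right, qbr_smul_right, qbr_smul_right, h3, h4,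
      qbr_one_qbr (-N.τ)]
    module

lemma IsStable.P_bracket_Q (h : N.IsStable M) (l : ℕ) :
    ∀ p q, l + p + q = M + 1 → l ≤ M →
      qbr 1 (N.P l 0) (N.Q p q) = (l : ℂ) • qbr 1 N.t (N.Q M 0) := by
  induction l with
  | zero =>
    intro p q _ _
    rw [N.P_zero_Q, Nat.cast_zero, zero_smul]
  | succ l ih =>
    intro p q hM hl
    have h0 := ih (p + 1) q (by omega) (by omega)
    have h1 := h.t_bracket l p q (by omega)
    have h2 := qbr_anti_sub_anti N.τ (N.P l 0) (N.X p) (N.Y q)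
    have h3 : qbr 1 N.t (qbr N.τ (N.X p) (qbr 1 (N.P l 0) (N.Y q)))
        = N.a • (qbr N.τ (N.X (p + 1)) (qbr 1 (N.P l 0) (N.Y q))
          - qbr N.τ (N.X p) (qbr 1 (N.P l 0) (N.Y (q + 1)))) := by
      rw [qbr_one_qbr N.τ, qbr_one_qbr 1 N.t, h.t_P_eq_zero (by omega), N.t_X, N.t_Y]
      simp only [qbr_zero_left, qbr_smul_right, qbr_smul_left, zero_add]
      module
    rw [h3, mul_smul, ← smul_sub] at h1
    have h4 := smul_right_injective A N.a_ne h1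
    rw [Q, qbr_one_qbr] at h0
    rw [Q, qbr_one_qbr, N.P_succ_X, h.P_succ_zero_Y hl]
    simp only [qbr_add_left, qbr_sub_right, qbr_smul_left, qbr_smul_right]
    push_cast
    linear_combination (norm := module) h0 - h4 + N.κ • h2

lemma IsStable.u_P_eq (h : N.IsStable M) :
    qbr 1 N.u (N.P M 0) = -((M : ℂ) • qbr 1 N.t (N.Q M 0)) := by
  have h1 := h.P_bracket_Q M 1 0 (by omega) le_rfl
  have h2 : N.u = N.Q 1 0 - N.c • (N.Q 0 0 * N.Q 0 0) := N.u_eq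
  rw [h2, qbr_sub_left, qbr_smul_left, qbr_one_mul_self_of_eq_zero _ _ (N.Q_zero_P M 0),
    qbr_one_swap, h1, smul_zero, sub_zero]

lemma IsStable.t_Q_top (h : N.IsStable M) : qbr 1 N.t (N.Q M 0) = 0 := by
  have h1 := h.u_P_eq
  have h2 : qbr 1 N.t (N.Q M 0) = -((M : ℂ) • qbr 1 N.u (N.P M 0)) := h.swap.u_P_eq
  by_cases hM1 : M = 1
  · subst hM1
    have h3 : N.t = N.P 1 0 - N.c • (N.P 0 0 * N.P 0 0) := N.t_eq
    have h4 : qbr 1 (N.P 1 0) (N.Q 1 0) = 0 := N.h_comm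
    rw [h3, qbr_sub_left, qbr_smul_left, qbr_one_mul_self_of_eq_zero _ _ (N.P_zero_Q 1 0), h4,
      smul_zero, sub_zero]
  · rw [h1] at h2
    have h3 : ((M : ℂ) ^ 2 - 1) • qbr 1 N.t (N.Q M 0) = 0 := by
      linear_combination (norm := module) -h2
    refine (smul_eq_zero.mp h3).resolve_left fun h4 => hM1 ?_
    have h5 : ((M ^ 2 : ℕ) : ℂ) = (1 : ℕ) := by push_cast; linear_combination h4
    have h6 := Nat.cast_injective h5
    exact (Nat.pow_eq_one.mp h6).resolve_right (by norm_num)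

lemma IsStable.Q_eq_succ (h : N.IsStable M) (r s : ℕ) (hrs : r + s = M + 1) :
    N.Q r s = N.Q (r + s) 0 := by
  induction s generalizing r with
  | zero => rfl
  | succ s ih =>
    have h1 := N.t_Q r s
    rw [h.2.1 r s (by omega), show r + s = M by omega, h.t_Q_top] at h1
    have h2 := (smul_eq_zero.mp h1.symm).resolve_left N.a_ne
    rw [← sub_eq_zero.mp h2, ih (r + 1) (by omega)]
    congr 1; omega

lemma IsStable.succ (h : N.IsStable M) : N.IsStable (M + 1) := by
  refine ⟨fun r s hrs => ?_, fun r s hrs => ?_, fun l p q hl => ?_⟩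
  · rcases Nat.lt_or_ge (r + s) (M + 1) with h1 | h1
    · exact h.1 r s (by omega)
    · exact h.swap.Q_eq_succ r s (by omega)
  · rcases Nat.lt_or_ge (r + s) (M + 1) with h1 | h1
    · exact h.2.1 r s (by omega)
    · exact h.Q_eq_succ r s (by omega)
  · rcases Nat.lt_or_ge (l + p + q) (M + 1) with h1 | h1
    · exact h.2.2 l p q (by omega)
    · rcases Nat.lt_or_ge M l with h2 | h2
      · obtain ⟨rfl, rfl⟩ : p = 0 ∧ q = 0 := by omega
        rw [qbr_one_swap, N.Q_zero_P, neg_zero]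
      · rw [h.P_bracket_Q l p q (by omega) h2, h.t_Q_top, smul_zero]

variable (N)

lemma isStable (M : ℕ) : N.IsStable M := by
  induction M with
  | zero =>
    refine ⟨fun r s h => ?_, fun r s h => ?_, fun l p q h => ?_⟩
    · obtain ⟨rfl, rfl⟩ : r = 0 ∧ s = 0 := by omega
      rfl
    · obtain ⟨rfl, rfl⟩ : r = 0 ∧ s = 0 := by omega
      rfl
    · obtain ⟨rfl, rfl, rfl⟩ : l = 0 ∧ p = 0 ∧ q = 0 := by omega
      exact N.P_zero_Q 0 0
  | succ M ih => exact ih.succ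

lemma u_P_eq_zero (M : ℕ) : qbr 1 N.u (N.P M 0) = 0 :=
  (N.isStable M).swap.t_Q_top

lemma P_zero_eq (s : ℕ) : N.P 0 s = N.P s 0 := by
  simpa using (N.isStable s).1 0 s (by omega)

/-- If the first node is odd, its Cartan modes commute with its positive modes. -/
lemma P_x (hσ : N.σ = -1) (h0 : N.x 0 * N.x 0 = 0) (r s : ℕ) :
    qbr 1 (N.P r 0) (N.x s) = 0 := by
  induction s with
  | zero =>
    have h1 : N.x 0 * (N.x 0 * N.y r) = 0 := by rw [← mul_assoc, h0, zero_mul]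
    rw [← N.P_zero_eq, P, hσ]
    simp [qbr, add_mul, mul_add, mul_assoc, h0, h1]
  | succ s ih =>
    have h1 := qbr_one_qbr 1 N.u (N.P r 0) (N.x s)
    rw [ih, N.u_P_eq_zero, N.u_x, qbr_zero_left, qbr_zero_right, qbr_smul_right, zero_add] at h1
    exact (smul_eq_zero.mp h1.symm).resolve_left N.a_ne

/-- If the first node is odd, its Cartan modes commute with its negative modes. -/
lemma P_y (hσ : N.σ = -1) (h0 : N.y 0 * N.y 0 = 0) (r s : ℕ) :
    qbr 1 (N.P r 0) (N.y s) = 0 := by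
  induction s with
  | zero =>
    have h1 : N.y 0 * (N.y 0 * N.x r) = 0 := by rw [← mul_assoc, h0, zero_mul]
    rw [P, hσ]
    simp [qbr, add_mul, mul_add, mul_assoc, h0, h1]
  | succ s ih =>
    have h1 := qbr_one_qbr 1 N.u (N.P r 0) (N.y s)
    rw [ih, N.u_P_eq_zero, N.u_y, qbr_zero_left, qbr_zero_right, qbr_smul_right, zero_add] at h1
    exact (smul_eq_zero.mp h1.symm).resolve_left (neg_ne_zero.mpr N.a_ne)

end LinkedNodes


section Shift

variable {t u : A} {z : ℕ → A} {μ ν : ℂ}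

/-- An element commuting with a shift operator acts on all modes as on the zeroth one. -/
lemma shift_of_zero (hμ : μ ≠ 0) (htu : qbr 1 t u = 0)
    (hu : ∀ r, qbr 1 u (z r) = μ • z (r + 1)) (h0 : qbr 1 t (z 0) = ν • z 1) (r : ℕ) :
    qbr 1 t (z r) = ν • z (r + 1) := by
  induction r with
  | zero => exact h0
  | succ r ih =>
    have h1 := qbr_one_qbr 1 t u (z r)
    rw [htu, ih, hu, qbr_smul_right, qbr_smul_right, hu, qbr_zero_left, zero_add,
      smul_comm ν μ] at h1
    exact smul_right_injective A hμ h1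

lemma weight_of_zero (hμ : μ ≠ 0) (htu : qbr 1 t u = 0)
    (hu : ∀ r, qbr 1 u (z r) = μ • z (r + 1)) (h0 : qbr 1 t (z 0) = ν • z 0) (r : ℕ) :
    qbr 1 t (z r) = ν • z r := by
  induction r with
  | zero => exact h0
  | succ r ih =>
    have h1 := qbr_one_qbr 1 t u (z r)
    rw [htu, ih, hu, qbr_smul_right, qbr_smul_right, hu, qbr_zero_left, zero_add,
      smul_comm ν μ] at h1
    exact smul_right_injective A hμ h1

/-- A family on a grid vanishes if it vanishes at the origin and two independent shift
operators act on it. -/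
lemma grid_eq_zero {F : ℕ → ℕ → A} {ξ : ℂ} (hμ : μ ≠ 0) (hν : ν ≠ 0) (h0 : F 0 0 = 0)
    (ht : ∀ r s, qbr 1 t (F r s) = ν • F r (s + 1))
    (hu : ∀ r s, qbr 1 u (F r s) = μ • F (r + 1) s + ξ • F r (s + 1)) (r s : ℕ) :
    F r s = 0 := by
  induction r generalizing s with
  | zero =>
    induction s with
    | zero => exact h0
    | succ s ih =>
      have h1 := ht 0 s
      rw [ih, qbr_zero_right] at h1
      exact (smul_eq_zero.mp h1.symm).resolve_left hν
  | succ r ih =>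
    have h1 := hu r s
    rw [ih, ih, qbr_zero_right, smul_zero, add_zero] at h1
    exact (smul_eq_zero.mp h1.symm).resolve_left hμ

end Shift

section Diagram

variable {m n : ℕ}

lemma ppar_of_le {k : ℕ} (h1 : 1 ≤ k) (h2 : k ≤ m) (hn : 1 ≤ n) :
    ppar m n (k : ZMod (m + n)) = 0 := by
  rw [ppar, ZMod.val_natCast_of_lt (by omega), if_pos ⟨h1, h2⟩]

lemma ppar_of_lt {k : ℕ} (h1 : m < k) (h2 : k ≤ m + n) :
    ppar m n (k : ZMod (m + n)) = 1 := by
  rcases h2.eq_or_lt with rfl | h2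
  · simp [ppar]
  · rw [ppar, ZMod.val_natCast_of_lt h2, if_neg (by omega)]

lemma natCast_ne_zero_of_lt {k : ℕ} (h1 : 0 < k) (h2 : k < m + n) : (k : ZMod (m + n)) ≠ 0 := by
  rw [Ne, ZMod.natCast_eq_zero_iff]
  exact fun h => absurd (Nat.le_of_dvd h1 h) (by omega)

/-- The Cartan data at an odd node `i` and its even successor. -/
structure OddEvenData (m n : ℕ) (i : ZMod (m + n)) : Prop where
  ne : i ≠ i + 1
  succ_not_odd : ¬(i + 1 = 0 ∨ i + 1 = (m : ZMod (m + n)))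
  gpar_eq : gpar m n i = 1
  gpar_succ : gpar m n (i + 1) = 0
  a_self : aC m n i i = 0
  a_succ_ne : aC m n i (i + 1) ≠ 0
  a_symm : aC m n (i + 1) i = aC m n i (i + 1)
  a_succ_succ_ne : aC m n (i + 1) (i + 1) ≠ 0
  b_add_ne : bC m n i (i + 1) + bC m n (i + 1) i ≠ 0

lemma oddEvenData (hm : 2 ≤ m) (hn : 2 ≤ n) {i : ZMod (m + n)}
    (hi : i = 0 ∨ i = (m : ZMod (m + n))) : OddEvenData m n i := by
  have e1 : (1 : ZMod (m + n)) ≠ 0 := by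
    simpa using natCast_ne_zero_of_lt (m := m) (n := n) (k := 1) (by omega) (by omega)
  have e2 : (2 : ZMod (m + n)) ≠ 0 := by
    simpa using natCast_ne_zero_of_lt (m := m) (n := n) (k := 2) (by omega) (by omega)
  have hne : i ≠ i + 1 := fun h => e1 (by simpa using h.symm)
  have hne2 : i ≠ i + 1 + 1 := fun h => e2 (by linear_combination -h)
  have hodd : ¬(i + 1 = 0 ∨ i + 1 = (m : ZMod (m + n))) := by
    rcases hi with rfl | rfl
    · rintro (h | h)
      · exact e1 (by simpa using h)
      · refine natCast_ne_zero_of_lt (m := m) (n := n) (k := m - 1) (by omega) (by omega) ?_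
        rw [Nat.cast_sub (by omega)]
        linear_combination -h
    · rintro (h | h)
      · refine natCast_ne_zero_of_lt (m := m) (n := n) (k := m + 1) (by omega) (by omega) ?_
        push_cast
        exact h
      · exact e1 (by linear_combination h)
  have hp : (ppar m n i = 1 ∧ ppar m n (i + 1) = 0 ∧ ppar m n (i + 1 + 1) = 0) ∨
      (ppar m n i = 0 ∧ ppar m n (i + 1) = 1 ∧ ppar m n (i + 1 + 1) = 1) := by
    rcases hi with rfl | rfl
    · left
      refine ⟨by simp [ppar], ?_, ?_⟩
      · have := ppar_of_le (m := m) (n := n) (k := 1) (by omega) (by omega) (by omega)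
        simpa using this
      · have := ppar_of_le (m := m) (n := n) (k := 2) (by omega) (by omega) (by omega)
        simpa [one_add_one_eq_two] using this
    · right
      refine ⟨ppar_of_le (by omega) le_rfl (by omega), ?_, ?_⟩
      · have := ppar_of_lt (m := m) (n := n) (k := m + 1) (by omega) (by omega)
        simpa using this
      · have := ppar_of_lt (m := m) (n := n) (k := m + 1 + 1) (by omega) (by omega)
        simpa using this
  have hb1 : ¬(i = ((m + n - 1 : ℕ) : ZMod (m + n)) ∧ i + 1 = 0) :=
    fun h => hodd (Or.inl h.2)
  have hb2 : ¬(i + 1 = ((m + n - 1 : ℕ) : ZMod (m + n)) ∧ i = 0) := by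
    rintro ⟨h, rfl⟩
    refine natCast_ne_zero_of_lt (m := m) (n := n) (k := m + n - 1 - 1) (by omega) (by omega) ?_
    rw [Nat.cast_sub (by omega), ← h]
    simp
  have ha : aZ m n i (i + 1) = -(-1) ^ ppar m n (i + 1) := by
    rw [aZ, if_neg hne, if_pos rfl]
  have ha' : aZ m n (i + 1) i = -(-1) ^ ppar m n (i + 1) := by
    rw [aZ, if_neg hne.symm, if_neg hne2, if_pos (by ring)]
  have hb : bC m n i (i + 1) = (-1) ^ ppar m n i := by
    rw [bC, if_neg hb1, if_neg hne2, if_pos (by ring)]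
  have hb' : bC m n (i + 1) i = -(-1) ^ ppar m n (i + 1 + 1) := by
    rw [bC, if_neg hb2, if_pos rfl]
  refine ⟨hne, hodd, ?_, ?_, ?_, ?_, ?_, ?_, ?_⟩
  · rcases hp with ⟨h1, h2, h3⟩ | ⟨h1, h2, h3⟩ <;> simp [gpar, h1, h2]
  · rcases hp with ⟨h1, h2, h3⟩ | ⟨h1, h2, h3⟩ <;> simp [gpar, h2, h3]
  · rcases hp with ⟨h1, h2, h3⟩ | ⟨h1, h2, h3⟩ <;> simp [aC, aZ, h1, h2]
  · simp [aC, ha]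
  · simp [aC, ha, ha']
  · rcases hp with ⟨h1, h2, h3⟩ | ⟨h1, h2, h3⟩ <;> norm_num [aC, aZ, h2, h3]
  · rw [hb, hb']
    rcases hp with ⟨h1, h2, h3⟩ | ⟨h1, h2, h3⟩ <;> norm_num [h1, h3]

end Diagram

lemma sgn_mul_self (b : Bool) : sgn b * sgn b = 1 := by cases b <;> simp [sgn]

lemma sgn_ne_zero (b : Bool) : sgn b ≠ 0 := by cases b <;> simp [sgn]

namespace YtildeRep

variable {m n : ℕ} {ε₁ ε₂ : ℂ} (R : YtildeRep m n ε₁ ε₂ A) {i : ZMod (m + n)}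

lemma H_comm_htld (j k : ZMod (m + n)) {r : ℕ} (hr : r ≤ 1) :
    qbr 1 (R.H j r) (htld m n ε₁ ε₂ R.H k) = 0 := by
  have h0 := R.rel21 j k r 0 hr (by omega)
  have h1 := R.rel21 j k r 1 hr le_rfl
  rw [qbr_one_swap, htld, qbr_sub_left, qbr_smul_left,
    qbr_one_mul_self_of_eq_zero _ _ ((qbr_one_eq_zero_iff _ _).mpr h0.symm),
    (qbr_one_eq_zero_iff _ _).mpr h1.symm, smul_zero, sub_zero, neg_zero]

lemma htld_comm_htld (j k : ZMod (m + n)) : qbr 1 (htld m n ε₁ ε₂ R.H j) (htld m n ε₁ ε₂ R.H k)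
    = 0 := by
  conv_lhs => enter [2]; rw [htld]
  rw [qbr_sub_left, qbr_smul_left, R.H_comm_htld j k le_rfl,
    qbr_one_mul_self_of_eq_zero _ _ (R.H_comm_htld j k zero_le_one), smul_zero, sub_zero]

lemma sbr_eq_qbr_one {p q : ℕ} (h : p * q = 0) (x y : A) : sbr p q x y = qbr 1 x y := by
  simp [sbr, qbr, h]

lemma X_true_X_false {j k : ZMod (m + n)} (hjk : j ≠ k) (h : gpar m n j * gpar m n k = 0) :
    qbr 1 (R.X true j 0) (R.X false k 0) = 0 := by
  rw [← sbr_eq_qbr_one h, R.rel22, if_neg hjk]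

lemma H_zero_X (b : Bool) (j k : ZMod (m + n)) :
    qbr 1 (R.H j 0) (R.X b k 0) = (sgn b * aC m n j k) • R.X b k 0 := by
  simpa [qbr] using R.rel24 b j k 0 zero_le_one

lemma htld_X_zero (hε : ε₁ = ε₂) (b : Bool) (j k : ZMod (m + n)) :
    qbr 1 (htld m n ε₁ ε₂ R.H j) (R.X b k 0) = (sgn b * aC m n j k) • R.X b k 1 := by
  simpa [qbr, hε] using R.rel25 b j k

lemma htld_succ_X (hε : ε₁ = ε₂) (D : OddEvenData m n i) (hi : i = 0 ∨ i = (m : ZMod (m + n)))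
    (b : Bool) (r : ℕ) :
    qbr 1 (htld m n ε₁ ε₂ R.H (i + 1)) (R.X b i r)
      = (sgn b * aC m n (i + 1) i) • R.X b i (r + 1) := by
  rcases Nat.eq_zero_or_pos r with rfl | hr
  · exact R.htld_X_zero hε b (i + 1) i
  · have h1 : aC m n (i + 1) i ≠ 0 := D.a_symm ▸ D.a_succ_ne
    have h2 : sgn b * aC m n (i + 1) i * (sgn b * (aC m n (i + 1) i)⁻¹) = 1 := by
      linear_combination sgn b * sgn b * mul_inv_cancel₀ h1 + sgn_mul_self b
    have h3 := R.recX b i r hr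
    rw [if_pos hi, sub_eq_zero.mpr hε, zero_div, mul_zero, zero_smul, add_zero] at h3
    rw [h3, smul_smul, h2, one_smul]
    simp [qbr]

lemma htld_succ_X_succ (hε : ε₁ = ε₂) (D : OddEvenData m n i) (b : Bool) (r : ℕ) :
    qbr 1 (htld m n ε₁ ε₂ R.H (i + 1)) (R.X b (i + 1) r)
      = (sgn b * aC m n (i + 1) (i + 1)) • R.X b (i + 1) (r + 1) := by
  rcases Nat.eq_zero_or_pos r with rfl | hr
  · exact R.htld_X_zero hε b (i + 1) (i + 1)
  · have h2 : sgn b * aC m n (i + 1) (i + 1) * (sgn b * (aC m n (i + 1) (i + 1))⁻¹) = 1 := by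
      linear_combination sgn b * sgn b * mul_inv_cancel₀ D.a_succ_succ_ne + sgn_mul_self b
    have h3 := R.recX b (i + 1) r hr
    rw [if_neg D.succ_not_odd] at h3
    rw [h3, smul_smul, h2, one_smul]
    simp [qbr]

lemma htld_X (hε : ε₁ = ε₂) (D : OddEvenData m n i) (hi : i = 0 ∨ i = (m : ZMod (m + n)))
    (b : Bool) (r : ℕ) :
    qbr 1 (htld m n ε₁ ε₂ R.H i) (R.X b i r) = (0 : ℂ) • R.X b i (r + 1) := by
  refine shift_of_zero (mul_ne_zero (sgn_ne_zero b) (D.a_symm ▸ D.a_succ_ne))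
    (R.htld_comm_htld i (i + 1)) (R.htld_succ_X hε D hi b) ?_ r
  rw [R.htld_X_zero hε, D.a_self, mul_zero]

lemma htld_X_succ (hε : ε₁ = ε₂) (D : OddEvenData m n i) (b : Bool) (r : ℕ) :
    qbr 1 (htld m n ε₁ ε₂ R.H i) (R.X b (i + 1) r)
      = (sgn b * aC m n i (i + 1)) • R.X b (i + 1) (r + 1) :=
  shift_of_zero (mul_ne_zero (sgn_ne_zero b) D.a_succ_succ_ne)
    (R.htld_comm_htld i (i + 1)) (R.htld_succ_X_succ hε D b) (R.htld_X_zero hε b i (i + 1)) r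

/-- Vanishing of the commutator of the zeroth modes propagates to all modes. -/
lemma X_comm_X_succ (hε : ε₁ = ε₂) (D : OddEvenData m n i) (hi : i = 0 ∨ i = (m : ZMod (m + n)))
    (b b' : Bool)
    (h0 : qbr 1 (R.X b i 0) (R.X b' (i + 1) 0) = 0) (r s : ℕ) :
    R.X b i r * R.X b' (i + 1) s = R.X b' (i + 1) s * R.X b i r := by
  rw [← qbr_one_eq_zero_iff]
  refine grid_eq_zero (F := fun r s => qbr 1 (R.X b i r) (R.X b' (i + 1) s))
    (t := htld m n ε₁ ε₂ R.H i) (u := htld m n ε₁ ε₂ R.H (i + 1))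
      (ξ := sgn b' * aC m n (i + 1) (i + 1))
    (mul_ne_zero (sgn_ne_zero b) (D.a_symm ▸ D.a_succ_ne))
    (mul_ne_zero (sgn_ne_zero b') D.a_succ_ne) h0
    (fun r s => ?_) (fun r s => ?_) r s
  · rw [qbr_one_qbr, R.htld_X hε D hi, R.htld_X_succ hε D, zero_smul, qbr_zero_left, zero_add,
      qbr_smul_right]
  · rw [qbr_one_qbr, R.htld_succ_X hε D hi, R.htld_succ_X_succ hε D, qbr_smul_left,
      qbr_smul_right]

/-- The quadratic relation between an odd node and its even successor extends to all modes. -/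
lemma X_X_succ (hε : ε₁ = ε₂) (D : OddEvenData m n i) (hi : i = 0 ∨ i = (m : ZMod (m + n)))
    (b : Bool) (r s : ℕ) :
    qbr 1 (R.X b i (r + 1)) (R.X b (i + 1) s) - qbr 1 (R.X b i r) (R.X b (i + 1) (s + 1))
      = (sgn b * aC m n i (i + 1) * ((ε₁ + ε₂) / 2))
          • qbr (-1) (R.X b i r) (R.X b (i + 1) s) := by
  rw [← sub_eq_zero]
  refine grid_eq_zero (F := fun r s =>
      qbr 1 (R.X b i (r + 1)) (R.X b (i + 1) s) - qbr 1 (R.X b i r) (R.X b (i + 1) (s + 1))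
      - (sgn b * aC m n i (i + 1) * ((ε₁ + ε₂) / 2)) • qbr (-1) (R.X b i r) (R.X b (i + 1) s))
    (t := htld m n ε₁ ε₂ R.H i) (u := htld m n ε₁ ε₂ R.H (i + 1))
      (ξ := sgn b * aC m n (i + 1) (i + 1))
    (mul_ne_zero (sgn_ne_zero b) (D.a_symm ▸ D.a_succ_ne))
    (mul_ne_zero (sgn_ne_zero b) D.a_succ_ne) ?_
    (fun r s => ?_) (fun r s => ?_) r s
  · have h1 := R.rel26 b i (i + 1)
    have hg : gpar m n i * gpar m n (i + 1) = 0 := by rw [D.gpar_succ, mul_zero]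
    simp only [sbr_eq_qbr_one hg] at h1
    rw [sub_eq_zero.mpr hε, zero_div, mul_zero, zero_smul, sub_zero] at h1
    rw [sub_eq_zero, h1]
    simp [acm, qbr]
  · simp only [qbr_sub_right, qbr_smul_right, qbr_one_qbr _ (htld m n ε₁ ε₂ R.H i),
      R.htld_X hε D hi,
      R.htld_X_succ hε D, zero_smul, qbr_zero_left, zero_add]
    module
  · simp only [qbr_sub_right, qbr_smul_right, qbr_smul_left,
      qbr_one_qbr _ (htld m n ε₁ ε₂ R.H (i + 1)),
      R.htld_succ_X hε D hi, R.htld_succ_X_succ hε D]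
    module

lemma H_zero_X_all (hε : ε₁ = ε₂) (D : OddEvenData m n i) (hi : i = 0 ∨ i = (m : ZMod (m + n)))
    (b : Bool) (j : ZMod (m + n)) (r : ℕ) :
    qbr 1 (R.H j 0) (R.X b i r) = (sgn b * aC m n j i) • R.X b i r :=
  weight_of_zero (mul_ne_zero (sgn_ne_zero b) (D.a_symm ▸ D.a_succ_ne))
    (R.H_comm_htld j (i + 1) zero_le_one) (R.htld_succ_X hε D hi b) (R.H_zero_X b j i) r

lemma H_zero_X_succ_all (hε : ε₁ = ε₂) (D : OddEvenData m n i) (b : Bool) (j : ZMod (m + n))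
    (r : ℕ) :
    qbr 1 (R.H j 0) (R.X b (i + 1) r) = (sgn b * aC m n j (i + 1)) • R.X b (i + 1) r :=
  weight_of_zero (mul_ne_zero (sgn_ne_zero b) D.a_succ_succ_ne)
    (R.H_comm_htld j (i + 1) zero_le_one) (R.htld_succ_X_succ hε D b) (R.H_zero_X b j (i + 1)) r

lemma H_zero_eq (D : OddEvenData m n i) : qbr (-1) (R.X true i 0) (R.X false i 0) = R.H i 0 := by
  simpa [sbr, qbr, D.gpar_eq] using R.rel22 i i

lemma H_one_eq (D : OddEvenData m n i) : qbr (-1) (R.X true i 1) (R.X false i 0) = R.H i 1 := by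
  simpa [sbr, qbr, D.gpar_eq] using R.rel23a i i

lemma H_eq (D : OddEvenData m n i) (r : ℕ) : R.H i r = qbr (-1) (R.X true i r) (R.X false i 0) := by
  match r with
  | 0 => exact (R.H_zero_eq D).symm
  | 1 => exact (R.H_one_eq D).symm
  | r + 2 => simpa [sbr, qbr, D.gpar_eq] using R.recH i (r + 1) (by omega)

lemma H_one_eq_bis (D : OddEvenData m n i) : qbr (-1) (R.X true i 0) (R.X false i 1) = R.H i 1 := by
  simpa [sbr, qbr, D.gpar_eq] using R.rel23b i i

lemma H_succ_zero_eq (D : OddEvenData m n i) : qbr 1 (R.X true (i + 1) 0) (R.X false (i + 1) 0)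
    = R.H (i + 1) 0 := by
  simpa [sbr, qbr, D.gpar_succ] using R.rel22 (i + 1) (i + 1)

lemma H_succ_one_eq (D : OddEvenData m n i) : qbr 1 (R.X true (i + 1) 1) (R.X false (i + 1) 0)
    = R.H (i + 1) 1 := by
  simpa [sbr, qbr, D.gpar_succ] using R.rel23a (i + 1) (i + 1)

lemma H_succ_one_eq_bis (D : OddEvenData m n i) : qbr 1 (R.X true (i + 1) 0) (R.X false (i + 1) 1)
    = R.H (i + 1) 1 := by
  simpa [sbr, qbr, D.gpar_succ] using R.rel23b (i + 1) (i + 1)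

lemma X_true_X_succ_false (D : OddEvenData m n i) : qbr 1 (R.X true i 0) (R.X false (i + 1) 0)
    = 0 :=
  R.X_true_X_false D.ne (by rw [D.gpar_succ, mul_zero])

lemma X_false_X_succ_true (D : OddEvenData m n i) : qbr 1 (R.X false i 0) (R.X true (i + 1) 0)
    = 0 := by
  rw [qbr_one_swap, R.X_true_X_false D.ne.symm (by rw [D.gpar_succ, zero_mul]), neg_zero]

/-- An odd node and its even successor, when the two parameters agree. -/
def linkedNodes (hε : ε₁ = ε₂) (D : OddEvenData m n i) (hi : i = 0 ∨ i = (m : ZMod (m + n))) :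
    LinkedNodes A where
  σ := -1
  τ := 1
  a := aC m n i (i + 1)
  α := 0
  β := aC m n (i + 1) (i + 1)
  κ := aC m n i (i + 1) * ((ε₁ + ε₂) / 2)
  c := (ε₁ + ε₂) / 2
  x := R.X true i
  y := R.X false i
  X := R.X true (i + 1)
  Y := R.X false (i + 1)
  t := htld m n ε₁ ε₂ R.H i
  u := htld m n ε₁ ε₂ R.H (i + 1)
  a_ne := D.a_succ_ne
  t_x := R.htld_X hε D hi true
  t_y r := by rw [neg_zero]; exact R.htld_X hε D hi false r
  t_X r := by simpa [sgn] using R.htld_X_succ hε D true r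
  t_Y r := by simpa [sgn] using R.htld_X_succ hε D false r
  u_x r := by simpa [sgn, D.a_symm] using R.htld_succ_X hε D hi true r
  u_y r := by simpa [sgn, D.a_symm] using R.htld_succ_X hε D hi false r
  u_X r := by simpa [sgn] using R.htld_succ_X_succ hε D true r
  u_Y r := by simpa [sgn] using R.htld_succ_X_succ hε D false r
  x_Y := R.X_comm_X_succ hε D hi true false (R.X_true_X_succ_false D)
  y_X := R.X_comm_X_succ hε D hi false true (R.X_false_X_succ_true D)
  x_X r s := by simpa [sgn] using R.X_X_succ hε D hi true r s
  y_Y r s := by simpa [sgn] using R.X_X_succ hε D hi false r s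
  h_X r := by rw [R.H_zero_eq D]; simpa [sgn] using R.H_zero_X_succ_all hε D true i r
  h_Y r := by rw [R.H_zero_eq D]; simpa [sgn] using R.H_zero_X_succ_all hε D false i r
  h_x r := by
    rw [R.H_succ_zero_eq D]; simpa [sgn, D.a_symm] using R.H_zero_X_all hε D hi true (i + 1) r
  h_y r := by
    rw [R.H_succ_zero_eq D]; simpa [sgn, D.a_symm] using R.H_zero_X_all hε D hi false (i + 1) r
  h_fst := by rw [R.H_one_eq D, R.H_one_eq_bis D]
  h_snd := by rw [R.H_succ_one_eq D, R.H_succ_one_eq_bis D]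
  h_comm := by
    rw [R.H_one_eq D, R.H_succ_one_eq D, qbr_one_eq_zero_iff]
    exact R.rel21 i (i + 1) 1 1 le_rfl le_rfl
  t_eq := by rw [R.H_one_eq D, R.H_zero_eq D]; rfl
  u_eq := by rw [R.H_succ_one_eq D, R.H_succ_zero_eq D]; rfl

lemma H_comm_X_of_eq (hε : ε₁ = ε₂) (D : OddEvenData m n i) (hi : i = 0 ∨ i = (m : ZMod (m + n)))
    (b : Bool) (r s : ℕ) :
    R.H i r * R.X b i s = R.X b i s * R.H i r := by
  have hsq (b : Bool) : R.X b i 0 * R.X b i 0 = 0 := by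
    have h1 := R.rel28 b i hi
    rw [D.gpar_eq] at h1
    have h2 : (2 : ℂ) • (R.X b i 0 * R.X b i 0) = 0 := by
      rw [two_smul]; simpa [sbr] using h1
    exact (smul_eq_zero.mp h2).resolve_left two_ne_zero
  rw [← qbr_one_eq_zero_iff, R.H_eq D]
  cases b with
  | true => exact (R.linkedNodes hε D hi).P_x rfl (hsq true) r s
  | false => exact (R.linkedNodes hε D hi).P_y rfl (hsq false) r s

/-- For distinct parameters, the two instances of the quadratic relation at `(i, i + 1)` and
`(i + 1, i)` only agree if the modes at the odd node `i` vanish. -/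
lemma X_zero_eq_zero (hε : ε₁ ≠ ε₂) (D : OddEvenData m n i) (b : Bool) : R.X b i 0 = 0 := by
  have h1 := R.rel26 b i (i + 1)
  have h2 := R.rel26 b (i + 1) i
  have hg : gpar m n i * gpar m n (i + 1) = 0 := by rw [D.gpar_succ, mul_zero]
  have hg' : gpar m n (i + 1) * gpar m n i = 0 := by rw [D.gpar_succ, zero_mul]
  simp only [sbr_eq_qbr_one hg] at h1
  simp only [sbr_eq_qbr_one hg'] at h2
  rw [D.a_symm] at h2
  have h3 : ((bC m n i (i + 1) + bC m n (i + 1) i) * ((ε₁ - ε₂) / 2))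
      • qbr 1 (R.X b i 0) (R.X b (i + 1) 0) = 0 := by
    simp only [qbr, acm] at h1 h2 ⊢
    linear_combination (norm := module) h1 - h2
  have h4 : qbr 1 (R.X b i 0) (R.X b (i + 1) 0) = 0 :=
    (smul_eq_zero.mp h3).resolve_left
      (mul_ne_zero D.b_add_ne (div_ne_zero (sub_ne_zero.mpr hε) two_ne_zero))
  have h5 : qbr 1 (R.X (!b) (i + 1) 0) (R.X b i 0) = 0 := by
    rw [qbr_one_swap, neg_eq_zero]
    cases b with
    | true => exact R.X_true_X_succ_false D
    | false => exact R.X_false_X_succ_true D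
  have h6 := qbr_one_qbr 1 (R.X (!b) (i + 1) 0) (R.X b i 0) (R.X b (i + 1) 0)
  rw [h4, h5, qbr_zero_right, qbr_zero_left, zero_add] at h6
  have h7 : qbr 1 (R.X (!b) (i + 1) 0) (R.X b (i + 1) 0) = (-sgn b) • R.H (i + 1) 0 := by
    rw [← R.H_succ_zero_eq D]
    cases b with
    | true => simpa [sgn] using qbr_one_swap (R.X false (i + 1) 0) (R.X true (i + 1) 0)
    | false => simp [sgn]
  rw [h7, qbr_smul_right, qbr_one_swap, R.H_zero_X, smul_neg, neg_smul, neg_neg, smul_smul,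
    ← mul_assoc, sgn_mul_self, one_mul] at h6
  exact (smul_eq_zero.mp h6.symm).resolve_left
    (D.a_symm ▸ D.a_succ_ne)

lemma X_eq_zero (hε : ε₁ ≠ ε₂) (D : OddEvenData m n i) (hi : i = 0 ∨ i = (m : ZMod (m + n)))
    (b : Bool) (r : ℕ) : R.X b i r = 0 := by
  induction r with
  | zero => exact R.X_zero_eq_zero hε D b
  | succ r ih =>
    rcases Nat.eq_zero_or_pos r with rfl | hr
    · have h1 := R.rel25 b (i + 1) i
      rw [ih, mul_zero, zero_mul, smul_zero, sub_zero, sub_zero] at h1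
      exact (smul_eq_zero.mp h1.symm).resolve_left
        (mul_ne_zero (sgn_ne_zero b) (D.a_symm ▸ D.a_succ_ne))
    · rw [R.recX b i r hr, if_pos hi, ih]
      simp

/-- The Cartan modes at an odd node commute with the odd modes at the same node. -/
lemma H_comm_X (D : OddEvenData m n i) (hi : i = 0 ∨ i = (m : ZMod (m + n))) (b : Bool)
    (r s : ℕ) : R.H i r * R.X b i s = R.X b i s * R.H i r := by
  by_cases hε : ε₁ = ε₂
  · exact R.H_comm_X_of_eq hε D hi b r s
  · rw [R.X_eq_zero hε D hi, mul_zero, zero_mul]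

lemma H_comm_H (D : OddEvenData m n i) (hi : i = 0 ∨ i = (m : ZMod (m + n))) (r s : ℕ) :
    R.H i r * R.H i s = R.H i s * R.H i r := by
  have h (b : Bool) (q : ℕ) : qbr 1 (R.H i r) (R.X b i q) = 0 :=
    (qbr_one_eq_zero_iff _ _).mpr (R.H_comm_X D hi b r q)
  rw [← qbr_one_eq_zero_iff, R.H_eq D s, qbr_one_qbr, h, h, qbr_zero_left, qbr_zero_right,
    add_zero]

end YtildeRep

theorem affine_super_yangian_stmt12
    (m n : ℕ) (hm : 2 ≤ m) (hn : 2 ≤ n) (hmn : m ≠ n) (ε₁ ε₂ : ℂ)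
    (B : Type*) [Ring B] [Algebra ℂ B] (R : YtildeRep m n ε₁ ε₂ B)
    (i : ZMod (m + n)) (hi : i = 0 ∨ i = (m : ZMod (m + n))) (r s : ℕ) :
    (∀ b : Bool, R.H i r * R.X b i s = R.X b i s * R.H i r) ∧
    (R.H i r * R.H i s = R.H i s * R.H i r) := by
  have D := oddEvenData hm hn hi
  exact ⟨fun b => R.H_comm_X D hi b r s, R.H_comm_H D hi r s⟩

end
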